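/- There is an explicit nonzero constant c (depending only on the Fourier normalization; c = (2π)^{1/2} with the stated convention) such that for all Schwartz functions f, g, h on ℝ and all ξ, η, σ ∈ ℝ, (F₂^{-1} G_ξ[f,g,h])(η,σ) = c ∫_ℝ f(z−η) ḡ(z) h(z−σ) e^{iξ(η+σ−z)} dz. In particular |(F₂^{-1} G_ξ[f,g,h])(η,σ)| ≤ |c| ∫_ℝ |f(z−η) g(z) h(z−σ)| dz uniformly in ξ. -/

import Mathlib

noncomputable section
open MeasureTheory Complex Real Filter Set ENNReal

/-- 1D Fourier transform with convention `(2π)^{-1/2} ∫ e^{-ixξ} f(x) dx`. -/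
def ft (f : ℝ → ℂ) (ξ : ℝ) : ℂ :=
  (((2 * π) ^ (-(1:ℝ)/2) : ℝ) : ℂ) * ∫ x : ℝ, Complex.exp (-(Complex.I * x * ξ)) * f x

/-- 1D inverse Fourier transform. -/
def ift (f : ℝ → ℂ) (x : ℝ) : ℂ :=
  (((2 * π) ^ (-(1:ℝ)/2) : ℝ) : ℂ) * ∫ ξ : ℝ, Complex.exp (Complex.I * x * ξ) * f ξ

/-- The Schrödinger group `e^{itΔ} f = 𝓕⁻¹ (e^{-itξ²} 𝓕 f)`. -/
def schrodinger (t : ℝ) (f : ℝ → ℂ) : ℝ → ℂ :=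
  ift fun ξ => Complex.exp (-(Complex.I * t * ξ ^ 2)) * ft f ξ

/-- Japanese bracket `⟨x⟩ = (1+x²)^{1/2}`. -/
def jb (x : ℝ) : ℝ := Real.sqrt (1 + x ^ 2)

/-- Inverse Fourier transform on `ℝ²` with convention `(2π)^{-1} ∫ e^{ip·q} G(q) dq`. -/
def ift2 (G : ℝ × ℝ → ℂ) (p : ℝ × ℝ) : ℂ :=
  (((2 * π)⁻¹ : ℝ) : ℂ) * ∫ q : ℝ × ℝ, Complex.exp (Complex.I * (p.1 * q.1 + p.2 * q.2)) * G q

/-- The trilinear kernel `G_ξ[f,g,h](η,σ) = f̂(ξ-η) (ḡ)^(η-ξ+σ) ĥ(ξ-σ)`. -/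
def Gker (f g h : ℝ → ℂ) (ξ : ℝ) (p : ℝ × ℝ) : ℂ :=
  ft f (ξ - p.1) * ft (fun x => (starRingEnd ℂ) (g x)) (p.1 - ξ + p.2) * ft h (ξ - p.2)

theorem ft_eq_fourier (f : ℝ → ℂ) (ξ : ℝ) :
    ft f ξ = (((2 * π) ^ (-(1:ℝ)/2) : ℝ) : ℂ) * FourierTransform.fourier f (ξ / (2 * π)) := by
  rw [ft, Real.fourier_real_eq_integral_exp_smul]
  congr 2
  ext x
  rw [smul_eq_mul]
  congr 2
  have hπ : (π : ℂ) ≠ 0 := by exact_mod_cast Real.pi_ne_zero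
  push_cast
  field_simp

theorem integrable_ft (f : SchwartzMap ℝ ℂ) : Integrable (ft f) := by
  have hF : Integrable (FourierTransform.fourier (f : ℝ → ℂ)) :=
    (FourierTransform.fourier f).integrable
  rw [funext (ft_eq_fourier f)]
  exact (hF.comp_div Real.two_pi_pos.ne').const_mul _

theorem normalization_mul_self :
    (((2 * π) ^ (-(1:ℝ)/2) : ℝ) : ℂ) * (((2 * π) ^ (-(1:ℝ)/2) : ℝ) : ℂ) =
      (((2 * π)⁻¹ : ℝ) : ℂ) := by
  rw [← Complex.ofReal_mul, ← Real.rpow_add Real.two_pi_pos, ← Real.rpow_neg_one]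
  norm_num

/-- Fourier inversion for Schwartz functions. -/
theorem ift_ft (f : SchwartzMap ℝ ℂ) (x : ℝ) : ift (ft f) x = f x := by
  have hF : Integrable (FourierTransform.fourier (f : ℝ → ℂ)) :=
    (FourierTransform.fourier f).integrable
  have hinv := congrFun (f.continuous.fourierInv_fourier_eq f.integrable hF) x
  rw [Real.fourierInv_eq'] at hinv
  have hπ : (π : ℂ) ≠ 0 := by exact_mod_cast Real.pi_ne_zero
  have hscale := Measure.integral_comp_div
    (fun w : ℝ => Complex.exp (2 * π * Complex.I * x * w) *
      FourierTransform.fourier (f : ℝ → ℂ) w) (2 * π)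
  rw [abs_of_pos Real.two_pi_pos, Complex.real_smul] at hscale
  have hinv' : (∫ w : ℝ, Complex.exp (2 * π * Complex.I * x * w) *
      FourierTransform.fourier (f : ℝ → ℂ) w) = f x := by
    rw [← hinv]
    congr 1
    ext w
    rw [smul_eq_mul]
    congr 2
    simp only [RCLike.inner_apply, conj_trivial]
    push_cast
    ring
  rw [hinv'] at hscale
  have hint : (∫ ξ : ℝ, Complex.exp (Complex.I * x * ξ) * ft f ξ) =
      (((2 * π) ^ (-(1:ℝ)/2) : ℝ) : ℂ) * (((2 * π : ℝ) : ℂ) * f x) := by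
    rw [← hscale, ← integral_const_mul]
    congr 1
    ext ξ
    rw [ft_eq_fourier, mul_left_comm]
    congr 3
    push_cast
    field_simp
  rw [ift, hint, ← mul_assoc, normalization_mul_self, ← mul_assoc, ← Complex.ofReal_mul,
    inv_mul_cancel₀ Real.two_pi_pos.ne', Complex.ofReal_one, one_mul]

/-- Fourier inversion for the reflected and translated transform `a ↦ f̂(ξ - a)`. -/
theorem integral_exp_mul_ft_sub (f : SchwartzMap ℝ ℂ) (ξ x : ℝ) :
    (((2 * π) ^ (-(1:ℝ)/2) : ℝ) : ℂ) *
        ∫ a : ℝ, Complex.exp (-(Complex.I * x * a)) * ft f (ξ - a) =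
      Complex.exp (-(Complex.I * x * ξ)) * f x := by
  rw [← integral_sub_left_eq_self _ volume ξ, ← ift_ft f x, ift, mul_left_comm,
    ← integral_const_mul (Complex.exp _)]
  congr 2
  ext u
  rw [_root_.sub_sub_cancel, ← mul_assoc, ← Complex.exp_add]
  congr 2
  push_cast
  ring

theorem integrable_exp_mul_ft_mul_ft_mul (f g h : SchwartzMap ℝ ℂ) (ξ η σ : ℝ) :
    Integrable (Function.uncurry fun (q : ℝ × ℝ) (z : ℝ) =>
      Complex.exp (Complex.I * (η * q.1 + σ * q.2 - z * (q.1 - ξ + q.2))) *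
        (ft f (ξ - q.1) * ft h (ξ - q.2) * (starRingEnd ℂ) (g z)))
      ((volume : Measure (ℝ × ℝ)).prod volume) := by
  have hf : Integrable fun a : ℝ => ft f (ξ - a) := (integrable_ft f).comp_sub_left ξ
  have hh : Integrable fun b : ℝ => ft h (ξ - b) := (integrable_ft h).comp_sub_left ξ
  have hg : Integrable fun z : ℝ => (starRingEnd ℂ) (g z) :=
    (Complex.conjCLE : ℂ →L[ℝ] ℂ).integrable_comp g.integrable
  refine ((hf.mul_prod hh).mul_prod hg).bdd_mul (c := 1) ?_ (ae_of_all _ fun p => ?_)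
  · exact Continuous.aestronglyMeasurable (by fun_prop)
  · rw [mul_comm]
    exact_mod_cast (Complex.norm_exp_ofReal_mul_I
      (η * p.1.1 + σ * p.1.2 - p.2 * (p.1.1 - ξ + p.1.2))).le

theorem ift2_Gker (f g h : SchwartzMap ℝ ℂ) (ξ η σ : ℝ) :
    ift2 (Gker f g h ξ) (η, σ) =
      (((2 * π) ^ (-(1:ℝ)/2) : ℝ) : ℂ) * ∫ z : ℝ,
        f (z - η) * (starRingEnd ℂ) (g z) * h (z - σ) *
          Complex.exp (Complex.I * ξ * (η + σ - z)) := by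
  have hexpand : (∫ q : ℝ × ℝ, Complex.exp (Complex.I * (η * q.1 + σ * q.2)) *
        Gker f g h ξ q) =
      (((2 * π) ^ (-(1:ℝ)/2) : ℝ) : ℂ) * ∫ q : ℝ × ℝ, ∫ z : ℝ,
        Complex.exp (Complex.I * (η * q.1 + σ * q.2 - z * (q.1 - ξ + q.2))) *
          (ft f (ξ - q.1) * ft h (ξ - q.2) * (starRingEnd ℂ) (g z)) := by
    rw [← integral_const_mul]
    congr 1
    ext q
    have hconj : ∀ z : ℝ,
        Complex.exp (Complex.I * (η * q.1 + σ * q.2 - z * (q.1 - ξ + q.2))) *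
          (ft f (ξ - q.1) * ft h (ξ - q.2) * (starRingEnd ℂ) (g z)) =
        (Complex.exp (Complex.I * (η * q.1 + σ * q.2)) * ft f (ξ - q.1) * ft h (ξ - q.2)) *
          (Complex.exp (-(Complex.I * z * ((q.1 - ξ + q.2 : ℝ) : ℂ))) *
            (starRingEnd ℂ) (g z)) := by
      intro z
      rw [mul_sub, sub_eq_add_neg, Complex.exp_add]
      push_cast
      ring_nf
    simp_rw [hconj]
    rw [integral_const_mul, Gker, ft.eq_1 (fun x => (starRingEnd ℂ) (g x))]
    ring
  have hinner : ∀ z : ℝ,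
      (((2 * π)⁻¹ : ℝ) : ℂ) * (∫ q : ℝ × ℝ,
        Complex.exp (Complex.I * (η * q.1 + σ * q.2 - z * (q.1 - ξ + q.2))) *
          (ft f (ξ - q.1) * ft h (ξ - q.2) * (starRingEnd ℂ) (g z))) =
        f (z - η) * (starRingEnd ℂ) (g z) * h (z - σ) *
          Complex.exp (Complex.I * ξ * (η + σ - z)) := by
    intro z
    have hsplit : ∀ q : ℝ × ℝ,
        Complex.exp (Complex.I * (η * q.1 + σ * q.2 - z * (q.1 - ξ + q.2))) *
          (ft f (ξ - q.1) * ft h (ξ - q.2) * (starRingEnd ℂ) (g z)) =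
        (Complex.exp (Complex.I * z * ξ) * (starRingEnd ℂ) (g z)) *
          ((Complex.exp (-(Complex.I * ((z - η : ℝ) : ℂ) * q.1)) * ft f (ξ - q.1)) *
            (Complex.exp (-(Complex.I * ((z - σ : ℝ) : ℂ) * q.2)) * ft h (ξ - q.2))) := by
      intro q
      have hexp : Complex.exp (Complex.I * (η * q.1 + σ * q.2 - z * (q.1 - ξ + q.2))) =
          Complex.exp (Complex.I * z * ξ) *
            Complex.exp (-(Complex.I * ((z - η : ℝ) : ℂ) * q.1)) *
            Complex.exp (-(Complex.I * ((z - σ : ℝ) : ℂ) * q.2)) := by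
        rw [← Complex.exp_add, ← Complex.exp_add]
        congr 1
        push_cast
        ring
      rw [hexp]
      ring
    have hexp : Complex.exp (Complex.I * ξ * (η + σ - z)) =
        Complex.exp (Complex.I * z * ξ) *
          Complex.exp (-(Complex.I * ((z - η : ℝ) : ℂ) * ξ)) *
          Complex.exp (-(Complex.I * ((z - σ : ℝ) : ℂ) * ξ)) := by
      rw [← Complex.exp_add, ← Complex.exp_add]
      congr 1
      push_cast
      ring
    simp_rw [hsplit]
    rw [integral_const_mul, Measure.volume_eq_prod,
      integral_prod_mul
        (fun a : ℝ => Complex.exp (-(Complex.I * ((z - η : ℝ) : ℂ) * a)) * ft f (ξ - a))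
        (fun b : ℝ => Complex.exp (-(Complex.I * ((z - σ : ℝ) : ℂ) * b)) * ft h (ξ - b)),
      ← normalization_mul_self, hexp]
    linear_combination
      (Complex.exp (Complex.I * z * ξ) * (starRingEnd ℂ) (g z)) *
        congrArg₂ (· * ·) (integral_exp_mul_ft_sub f ξ (z - η))
          (integral_exp_mul_ft_sub h ξ (z - σ))
  rw [ift2, hexpand,
    integral_integral_swap (integrable_exp_mul_ft_mul_ft_mul f g h ξ η σ), mul_left_comm,
    ← integral_const_mul]
  simp_rw [hinner]

/-- explicit formula for `F₂⁻¹ G_ξ[f,g,h]` and the resulting uniform bound. -/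
theorem Gker_inverse_fourier_formula :
    ∃ c : ℂ, c ≠ 0 ∧
      (∀ f g h : SchwartzMap ℝ ℂ, ∀ ξ η σ : ℝ,
        ift2 (Gker ⇑f ⇑g ⇑h ξ) (η, σ) =
          c * ∫ z : ℝ,
            f (z - η) * (starRingEnd ℂ) (g z) * h (z - σ) *
              Complex.exp (Complex.I * ξ * (η + σ - z))) ∧
      (∀ f g h : SchwartzMap ℝ ℂ, ∀ ξ η σ : ℝ,
        ‖ift2 (Gker ⇑f ⇑g ⇑h ξ) (η, σ)‖ ≤
          ‖c‖ * ∫ z : ℝ, ‖f (z - η) * g z * h (z - σ)‖) := by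
  refine ⟨(((2 * π) ^ (-(1:ℝ)/2) : ℝ) : ℂ), ?_, ift2_Gker, fun f g h ξ η σ => ?_⟩
  · exact Complex.ofReal_ne_zero.mpr (Real.rpow_pos_of_pos Real.two_pi_pos _).ne'
  · rw [ift2_Gker, norm_mul]
    refine mul_le_mul_of_nonneg_left ?_ (norm_nonneg _)
    refine (norm_integral_le_integral_norm _).trans_eq ?_
    congr 1
    ext z
    have hexp : ‖Complex.exp (Complex.I * ξ * (η + σ - z))‖ = 1 := by
      rw [mul_assoc, mul_comm]
      exact_mod_cast Complex.norm_exp_ofReal_mul_I (ξ * (η + σ - z))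
    simp only [norm_mul, hexp, mul_one, RCLike.norm_conj]
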